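/- Consider the frame on {u ∈ ℝ³ : u¹u² ≠ 0} given by R₁ = (u¹, u², 0)ᵀ, R₂ = (−u², u¹, 0)ᵀ, R₃ = (0,0,1)ᵀ. For any C² functions G₁, G₃ of one variable, the functions β¹ = v·G₁(v), β² = √v·∫ G₁(τ²) dτ evaluated at √v (plus u¹·G₂(u²/u¹) for any G₂), β³ = G₃(u³), where v = (u¹)² + (u²)², satisfy the property that Lᵀ·diag(β¹,β²,β³)·L is a symmetric matrix whose curl vanishes (i.e. is a Jacobian), where L = R⁻¹ with R = [R₁|R₂|R₃]. -/

import Mathlib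

open Matrix

/-- Conjugating a diagonal matrix by the inverse of the rotation-dilation frame. -/
theorem frame_inv_conj_diagonal (x y : ℝ) (h : x ^ 2 + y ^ 2 ≠ 0) (b : Fin 3 → ℝ) :
    (!![x, -y, 0; y, x, 0; 0, 0, 1]⁻¹)ᵀ * Matrix.diagonal b * !![x, -y, 0; y, x, 0; 0, 0, 1]⁻¹ =
      !![(b 0 * (x * x) + b 1 * (y * y)) / (x ^ 2 + y ^ 2) ^ 2,
          (b 0 + -1 * b 1) * (x * y) / (x ^ 2 + y ^ 2) ^ 2, 0;
        (b 0 + -1 * b 1) * (x * y) / (x ^ 2 + y ^ 2) ^ 2,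
          (b 0 * (y * y) + b 1 * (x * x)) / (x ^ 2 + y ^ 2) ^ 2, 0;
        0, 0, b 2] := by
  have hinv : (!![x, -y, 0; y, x, 0; 0, 0, 1] : Matrix (Fin 3) (Fin 3) ℝ)⁻¹ =
      !![x / (x ^ 2 + y ^ 2), y / (x ^ 2 + y ^ 2), 0;
        -y / (x ^ 2 + y ^ 2), x / (x ^ 2 + y ^ 2), 0; 0, 0, 1] := by
    apply Matrix.inv_eq_right_inv
    ext i j
    fin_cases i <;> fin_cases j <;> simp [Matrix.mul_apply, Fin.sum_univ_three] <;>
      field_simp <;> ring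
  rw [hinv]
  ext i j
  fin_cases i <;> fin_cases j <;>
    simp [Matrix.mul_apply, Fin.sum_univ_three, Matrix.diagonal_apply] <;> field_simp

/-- The linear form `p dx + q dy` on `ℝ³`. -/
noncomputable def planarForm (p q : ℝ) : (Fin 3 → ℝ) →L[ℝ] ℝ :=
  p • ContinuousLinearMap.proj (R := ℝ) (φ := fun _ : Fin 3 => ℝ) 0 +
    q • ContinuousLinearMap.proj (R := ℝ) (φ := fun _ : Fin 3 => ℝ) 1

theorem planarForm_apply (p q : ℝ) (w : Fin 3 → ℝ) : planarForm p q w = p * w 0 + q * w 1 := by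
  simp [planarForm]

theorem hasFDerivAt_coord (i : Fin 3) (u : Fin 3 → ℝ) :
    HasFDerivAt (fun w : Fin 3 → ℝ => w i)
      (ContinuousLinearMap.proj (R := ℝ) (φ := fun _ : Fin 3 => ℝ) i) u :=
  (ContinuousLinearMap.proj (R := ℝ) (φ := fun _ : Fin 3 => ℝ) i).hasFDerivAt

theorem hasFDerivAt_planar_normSq (u : Fin 3 → ℝ) :
    HasFDerivAt (fun w : Fin 3 → ℝ => (w 0) ^ 2 + (w 1) ^ 2)
      (planarForm (2 * u 0) (2 * u 1)) u := by
  refine (((hasFDerivAt_coord 0 u).pow 2).add ((hasFDerivAt_coord 1 u).pow 2)).congr_fderiv ?_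
  ext1 w
  simp [planarForm_apply]

theorem hasFDerivAt_normSq_mul_comp {G : ℝ → ℝ} (hG : Differentiable ℝ G) (u : Fin 3 → ℝ) :
    ∃ c : ℝ, HasFDerivAt
      (fun w : Fin 3 → ℝ => ((w 0) ^ 2 + (w 1) ^ 2) * G ((w 0) ^ 2 + (w 1) ^ 2))
      (planarForm ((G ((u 0) ^ 2 + (u 1) ^ 2) + ((u 0) ^ 2 + (u 1) ^ 2) * c) * (2 * u 0))
        ((G ((u 0) ^ 2 + (u 1) ^ 2) + ((u 0) ^ 2 + (u 1) ^ 2) * c) * (2 * u 1))) u := by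
  refine ⟨deriv G ((u 0) ^ 2 + (u 1) ^ 2), ?_⟩
  have hv := hasFDerivAt_planar_normSq u
  refine (hv.mul
    ((hG ((u 0) ^ 2 + (u 1) ^ 2)).hasDerivAt.comp_hasFDerivAt u hv)).congr_fderiv ?_
  ext1 w
  simp [planarForm_apply]
  ring

theorem hasFDerivAt_radial_integral {G : ℝ → ℝ} (hG : Continuous G) (a : ℝ) (u : Fin 3 → ℝ)
    (hv : 0 < (u 0) ^ 2 + (u 1) ^ 2) :
    ∃ K : ℝ,
      √((u 0) ^ 2 + (u 1) ^ 2) * (∫ τ in a..√((u 0) ^ 2 + (u 1) ^ 2), G (τ ^ 2)) =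
        ((u 0) ^ 2 + (u 1) ^ 2) * K ∧
      HasFDerivAt
        (fun w : Fin 3 → ℝ =>
          √((w 0) ^ 2 + (w 1) ^ 2) * ∫ τ in a..√((w 0) ^ 2 + (w 1) ^ 2), G (τ ^ 2))
        (planarForm ((K + G ((u 0) ^ 2 + (u 1) ^ 2)) * u 0)
          ((K + G ((u 0) ^ 2 + (u 1) ^ 2)) * u 1)) u := by
  have hs : 0 < √((u 0) ^ 2 + (u 1) ^ 2) := Real.sqrt_pos.2 hv
  have hsq := Real.sq_sqrt hv.le
  have hd := (hasFDerivAt_planar_normSq u).sqrt hv.ne'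
  have hcont : Continuous fun τ : ℝ => G (τ ^ 2) := by fun_prop
  have hI := (hcont.integral_hasStrictDerivAt a √((u 0) ^ 2 + (u 1) ^ 2)).hasDerivAt
  refine ⟨(∫ τ in a..√((u 0) ^ 2 + (u 1) ^ 2), G (τ ^ 2)) / √((u 0) ^ 2 + (u 1) ^ 2), ?_, ?_⟩
  · nth_rewrite 3 [← hsq]
    field_simp
  · refine (hd.mul (hI.comp_hasFDerivAt u hd)).congr_fderiv ?_
    ext1 w
    simp only [planarForm_apply, Function.comp_apply, hsq, _root_.add_apply, _root_.smul_apply,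
      smul_eq_mul]
    field_simp
    ring

theorem hasFDerivAt_homogeneous {G : ℝ → ℝ} (hG : Differentiable ℝ G) (u : Fin 3 → ℝ)
    (hx : u 0 ≠ 0) :
    ∃ d : ℝ, HasFDerivAt (fun w : Fin 3 → ℝ => w 0 * G (w 1 / w 0))
      (planarForm (G (u 1 / u 0) - u 1 / u 0 * d) d) u := by
  refine ⟨deriv G (u 1 / u 0), ?_⟩
  have hq : HasFDerivAt (fun w : Fin 3 → ℝ => w 1 / w 0)
      (planarForm (-(u 1) / (u 0) ^ 2) (1 / u 0)) u := by
    simp only [div_eq_mul_inv (_ : ℝ) (_ : ℝ)]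
    refine ((hasFDerivAt_coord 1 u).mul
      ((hasDerivAt_inv hx).comp_hasFDerivAt u (hasFDerivAt_coord 0 u))).congr_fderiv ?_
    ext1 w
    simp [planarForm_apply]
    field_simp
  refine ((hasFDerivAt_coord 0 u).mul
    ((hG (u 1 / u 0)).hasDerivAt.comp_hasFDerivAt u hq)).congr_fderiv ?_
  ext1 w
  simp [planarForm_apply]
  field_simp
  ring

/-- Derivative of a planar quotient whose denominator is the square of `x² + y²`. -/
theorem HasFDerivAt.div_planar_normSq_sq {N : (Fin 3 → ℝ) → ℝ} {p q : ℝ} {u : Fin 3 → ℝ}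
    (hN : HasFDerivAt N (planarForm p q) u) (hv : (u 0) ^ 2 + (u 1) ^ 2 ≠ 0) :
    HasFDerivAt (fun w => N w / ((w 0) ^ 2 + (w 1) ^ 2) ^ 2)
      (planarForm
        ((p * ((u 0) ^ 2 + (u 1) ^ 2) - 4 * u 0 * N u) / ((u 0) ^ 2 + (u 1) ^ 2) ^ 3)
        ((q * ((u 0) ^ 2 + (u 1) ^ 2) - 4 * u 1 * N u) / ((u 0) ^ 2 + (u 1) ^ 2) ^ 3)) u := by
  simp only [div_eq_mul_inv]
  refine (hN.mul ((hasDerivAt_inv (pow_ne_zero 2 hv)).comp_hasFDerivAt u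
    ((hasFDerivAt_planar_normSq u).pow 2))).congr_fderiv ?_
  ext1 w
  simp [planarForm_apply]
  field_simp
  ring

theorem HasFDerivAt.planar_add {f g : (Fin 3 → ℝ) → ℝ} {p q p' q' : ℝ} {u : Fin 3 → ℝ}
    (hf : HasFDerivAt f (planarForm p q) u) (hg : HasFDerivAt g (planarForm p' q') u) :
    HasFDerivAt (fun w => f w + g w) (planarForm (p + p') (q + q')) u := by
  refine (hf.add hg).congr_fderiv ?_
  ext1 w
  simp [planarForm_apply]
  ring

/-- Block matrices `[[A, B], [B, C]] ⊕ [D]` with compatible partial derivatives are curl-free. -/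
theorem fderiv_block_curl_free {A B C D : (Fin 3 → ℝ) → ℝ} {p q q' r r' s t : ℝ} {u : Fin 3 → ℝ}
    {M : (Fin 3 → ℝ) → Matrix (Fin 3) (Fin 3) ℝ}
    (hM : ∀ᶠ w in nhds u, M w = !![A w, B w, 0; B w, C w, 0; 0, 0, D w])
    (hA : HasFDerivAt A (planarForm p q) u) (hB : HasFDerivAt B (planarForm q' r) u)
    (hC : HasFDerivAt C (planarForm r' s) u)
    (hD : HasFDerivAt D (t • ContinuousLinearMap.proj (R := ℝ) (φ := fun _ : Fin 3 => ℝ) 2) u)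
    (hq : q = q') (hr : r = r') (i j k : Fin 3) :
    fderiv ℝ (fun w => M w i j) u (Pi.single k 1) =
      fderiv ℝ (fun w => M w i k) u (Pi.single j 1) := by
  have hentry : ∀ i j, fderiv ℝ (fun w => M w i j) u =
      fderiv ℝ (fun w => !![A w, B w, 0; B w, C w, 0; 0, 0, D w] i j) u := fun i j =>
    Filter.EventuallyEq.fderiv_eq (hM.mono fun w hw => congrFun (congrFun hw i) j)
  subst hq hr
  rw [hentry, hentry]
  fin_cases i <;> fin_cases j <;> fin_cases k <;>
    simp [hA.fderiv, hB.fderiv, hC.fderiv, hD.fderiv, planarForm_apply]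

theorem HasFDerivAt.planar_mul {f g : (Fin 3 → ℝ) → ℝ} {p q p' q' : ℝ} {u : Fin 3 → ℝ}
    (hf : HasFDerivAt f (planarForm p q) u) (hg : HasFDerivAt g (planarForm p' q') u) :
    HasFDerivAt (fun w => f w * g w)
      (planarForm (p * g u + f u * p') (q * g u + f u * q')) u := by
  refine (hf.mul hg).congr_fderiv ?_
  ext1 w
  simp [planarForm_apply]
  ring

/-- Explicit solution of the β-system for the rich orthogonal frame
`R₁ = (u¹,u²,0)`, `R₂ = (−u²,u¹,0)`, `R₃ = (0,0,1)`: with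
`v = (u¹)² + (u²)²`, the matrix `Lᵀ·diag(β)·L` (where `L = R⁻¹`) is symmetric
and curl-free (i.e. a Jacobian) on `{u¹u² ≠ 0}`. -/
theorem stmt18 (G₁ G₂ G₃ : ℝ → ℝ)
    (hG₁ : ContDiff ℝ 2 G₁) (hG₂ : ContDiff ℝ 2 G₂) (hG₃ : ContDiff ℝ 2 G₃)
    (a : ℝ)
    (R : (Fin 3 → ℝ) → Matrix (Fin 3) (Fin 3) ℝ)
    (hR : ∀ u, R u = !![u 0, -(u 1), 0; u 1, u 0, 0; 0, 0, 1])
    (β : Fin 3 → (Fin 3 → ℝ) → ℝ)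
    (hβ0 : ∀ u : Fin 3 → ℝ,
      β 0 u = ((u 0) ^ 2 + (u 1) ^ 2) * G₁ ((u 0) ^ 2 + (u 1) ^ 2))
    (hβ1 : ∀ u : Fin 3 → ℝ,
      β 1 u = Real.sqrt ((u 0) ^ 2 + (u 1) ^ 2) *
          (∫ τ in a..Real.sqrt ((u 0) ^ 2 + (u 1) ^ 2), G₁ (τ ^ 2)) +
        u 0 * G₂ (u 1 / u 0))
    (hβ2 : ∀ u : Fin 3 → ℝ, β 2 u = G₃ (u 2))
    (M : (Fin 3 → ℝ) → Matrix (Fin 3) (Fin 3) ℝ)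
    (hM : ∀ u, M u = ((R u)⁻¹)ᵀ * Matrix.diagonal (fun i => β i u) * (R u)⁻¹) :
    ∀ u : Fin 3 → ℝ, u 0 * u 1 ≠ 0 →
      (M u).IsSymm ∧
      ∀ i j k : Fin 3,
        fderiv ℝ (fun w => M w i j) u (Pi.single k 1) =
          fderiv ℝ (fun w => M w i k) u (Pi.single j 1) := by
  intro u hu
  have hx : u 0 ≠ 0 := left_ne_zero_of_mul hu
  have hv : 0 < (u 0) ^ 2 + (u 1) ^ 2 := by positivity
  have hform : ∀ w : Fin 3 → ℝ, (w 0) ^ 2 + (w 1) ^ 2 ≠ 0 → M w =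
      !![(β 0 w * (w 0 * w 0) + β 1 w * (w 1 * w 1)) / (w 0 ^ 2 + w 1 ^ 2) ^ 2,
          (β 0 w + -1 * β 1 w) * (w 0 * w 1) / (w 0 ^ 2 + w 1 ^ 2) ^ 2, 0;
        (β 0 w + -1 * β 1 w) * (w 0 * w 1) / (w 0 ^ 2 + w 1 ^ 2) ^ 2,
          (β 0 w * (w 1 * w 1) + β 1 w * (w 0 * w 0)) / (w 0 ^ 2 + w 1 ^ 2) ^ 2, 0;
        0, 0, β 2 w] := fun w hw => by
    rw [hM, hR]
    exact frame_inv_conj_diagonal (w 0) (w 1) hw (fun i => β i w)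
  have hnear := ((hasFDerivAt_planar_normSq u).continuousAt.eventually_ne hv.ne').mono hform
  obtain ⟨c, hb0⟩ := hasFDerivAt_normSq_mul_comp (hG₁.differentiable two_ne_zero) u
  obtain ⟨K, hK, hKd⟩ := hasFDerivAt_radial_integral hG₁.continuous a u hv
  obtain ⟨d, hd⟩ := hasFDerivAt_homogeneous (hG₂.differentiable two_ne_zero) u hx
  have hb1 := hKd.planar_add hd
  rw [← funext hβ0] at hb0
  rw [← funext hβ1] at hb1
  have hb2 : HasFDerivAt (β 2) (deriv G₃ (u 2) •
      ContinuousLinearMap.proj (R := ℝ) (φ := fun _ : Fin 3 => ℝ) 2) u := by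
    rw [funext hβ2]
    exact ((hG₃.differentiable two_ne_zero) (u 2)).hasDerivAt.comp_hasFDerivAt u
      (hasFDerivAt_coord 2 u)
  have hX : HasFDerivAt (fun w : Fin 3 → ℝ => w 0) (planarForm 1 0) u := by
    simpa [planarForm] using hasFDerivAt_coord 0 u
  have hY : HasFDerivAt (fun w : Fin 3 → ℝ => w 1) (planarForm 0 1) u := by
    simpa [planarForm] using hasFDerivAt_coord 1 u
  have hneg : HasFDerivAt (fun _ : Fin 3 → ℝ => (-1 : ℝ)) (planarForm 0 0) u := by
    simpa [planarForm] using hasFDerivAt_const (-1 : ℝ) u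
  have e0 := hβ0 u
  have e1 := hβ1 u
  rw [hK] at e1
  have hA := ((hb0.planar_mul (hX.planar_mul hX)).planar_add
    (hb1.planar_mul (hY.planar_mul hY))).div_planar_normSq_sq hv.ne'
  have hB := ((hb0.planar_add (hneg.planar_mul hb1)).planar_mul
    (hX.planar_mul hY)).div_planar_normSq_sq hv.ne'
  have hC := ((hb0.planar_mul (hY.planar_mul hY)).planar_add
    (hb1.planar_mul (hX.planar_mul hX))).div_planar_normSq_sq hv.ne'
  refine ⟨?_, fderiv_block_curl_free hnear hA hB hC hb2 ?_ ?_⟩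
  · rw [hform u hv.ne']
    ext i j
    fin_cases i <;> fin_cases j <;> rfl
  · simp only [e0, e1]
    field_simp
    ring
  · simp only [e0, e1]
    field_simp
    ring
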